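/- Let k, ℓ ≥ 1 be integers, n ≥ 1, m ∈ ℝ, and let a ∈ Σ^{-m}_{k,ℓ} be a symbol on ℝⁿ × ℝⁿ ≅ ℝ^{2n}. Let φ(Y) = e^{−|Y|²} be the Gaussian window on ℝ^{2n} and define the short-time Fourier transform V_φ a(Z,W) = ∫_{ℝ^{2n}} a(Y) φ(Y−Z) e^{−i Y·W} dY. Then for every N ∈ ℕ there exists C_N > 0 such that for all Z = (z,ζ) ∈ ℝⁿ × ℝⁿ and W = (w,τ) ∈ ℝⁿ × ℝⁿ: |V_φ a(Z,W)| ≤ C_N (1 + |z|^k + |ζ|^ℓ)^{−m} (1 + |w|^k + |τ|^ℓ)^{−2N}. -/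

import Mathlib

open scoped RealInnerProductSpace

noncomputable section

/-- The coordinate direction in the phase space `ℝⁿ × ℝⁿ`. -/
def phaseDir (n : ℕ) (i : Fin n ⊕ Fin n) :
    EuclideanSpace ℝ (Fin n) × EuclideanSpace ℝ (Fin n) :=
  match i with
  | Sum.inl j => (EuclideanSpace.single j (1 : ℝ), 0)
  | Sum.inr j => (0, EuclideanSpace.single j (1 : ℝ))

/-- Iterated coordinate partial derivatives along the list of directions `L`. -/
def pderivSeq (n : ℕ) : List (Fin n ⊕ Fin n) →
    ((EuclideanSpace ℝ (Fin n) × EuclideanSpace ℝ (Fin n)) → ℂ) →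
    ((EuclideanSpace ℝ (Fin n) × EuclideanSpace ℝ (Fin n)) → ℂ)
  | [], f => f
  | (i :: L), f => fun p => fderiv ℝ (pderivSeq n L f) p (phaseDir n i)

/-- Membership in the anharmonic symbol class `Σ^m_{k,ℓ}`: `a` is smooth and each mixed
coordinate derivative `∂_x^β ∂_ξ^α a` is bounded by
`C_{αβ}(1+|x|^k+|ξ|^ℓ)^{m-|β|/k-|α|/ℓ}`. -/
def SigmaClass (n k l : ℕ) (m : ℝ)
    (a : (EuclideanSpace ℝ (Fin n) × EuclideanSpace ℝ (Fin n)) → ℂ) : Prop :=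
  ContDiff ℝ (⊤ : ℕ∞) a ∧
  ∀ (β α : List (Fin n)), ∃ C : ℝ, 0 < C ∧
    ∀ x ξ : EuclideanSpace ℝ (Fin n),
      ‖pderivSeq n (β.map Sum.inl ++ α.map Sum.inr) a (x, ξ)‖ ≤
        C * (1 + ‖x‖ ^ k + ‖ξ‖ ^ l) ^ (m - (β.length : ℝ) / k - (α.length : ℝ) / l)

/-- The short-time Fourier transform on `ℝ^{2n} ≅ ℝⁿ × ℝⁿ` with respect to the Gaussian
window `φ(Y) = e^{-|Y|²}`: `V_φ a (Z, W) = ∫ a(Y) φ(Y-Z) e^{-i Y·W} dY`. -/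
def STFT2n (n : ℕ) (a : (EuclideanSpace ℝ (Fin n) × EuclideanSpace ℝ (Fin n)) → ℂ)
    (Z W : EuclideanSpace ℝ (Fin n) × EuclideanSpace ℝ (Fin n)) : ℂ :=
  ∫ Y : EuclideanSpace ℝ (Fin n) × EuclideanSpace ℝ (Fin n),
    a Y * Complex.exp (-((‖Y.1 - Z.1‖ ^ 2 + ‖Y.2 - Z.2‖ ^ 2 : ℝ) : ℂ)) *
      Complex.exp (-Complex.I * ((⟪Y.1, W.1⟫ + ⟪Y.2, W.2⟫ : ℝ) : ℂ))

/-- The phase space `ℝⁿ × ℝⁿ`. -/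
abbrev PhaseSpace (n : ℕ) := EuclideanSpace ℝ (Fin n) × EuclideanSpace ℝ (Fin n)

instance PhaseSpace.isAddHaarMeasure_volume (n : ℕ) :
    (MeasureTheory.volume : MeasureTheory.Measure (PhaseSpace n)).IsAddHaarMeasure :=
  MeasureTheory.Measure.prod.instIsAddHaarMeasure _ _

/-- The Euclidean inner product of `ℝⁿ × ℝⁿ ≅ ℝ²ⁿ`. -/
def phaseInner {n : ℕ} (X Y : PhaseSpace n) : ℝ := ⟪X.1, Y.1⟫ + ⟪X.2, Y.2⟫

/-- The weight `1 + |x|^k + |ξ|^ℓ`. -/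
def anharmonicWeight {n : ℕ} (k l : ℕ) (X : PhaseSpace n) : ℝ := 1 + ‖X.1‖ ^ k + ‖X.2‖ ^ l

/-- A Gaussian centred at `Z`, multiplied by a polynomial in the coordinate along `v`. -/
def hermiteAtom {n : ℕ} (q : Polynomial ℝ) (v Z Y : PhaseSpace n) : ℝ :=
  q.eval (phaseInner (Y - Z) v) * Real.exp (-phaseInner (Y - Z) (Y - Z))

/-- The plane wave `e^{-i Y·W}`. -/
def planeWave {n : ℕ} (W Y : PhaseSpace n) : ℂ := Complex.exp (-Complex.I * (phaseInner Y W : ℂ))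

lemma norm_planeWave {n : ℕ} (W Y : PhaseSpace n) : ‖planeWave W Y‖ = 1 := by
  simp [planeWave, Complex.norm_exp]

lemma phaseInner_self {n : ℕ} (u : PhaseSpace n) : phaseInner u u = ‖u.1‖ ^ 2 + ‖u.2‖ ^ 2 := by
  simp [phaseInner]

lemma sq_norm_le_phaseInner_self {n : ℕ} (u : PhaseSpace n) : ‖u‖ ^ 2 ≤ phaseInner u u := by
  rw [phaseInner_self, Prod.norm_def]
  rcases max_choice ‖u.1‖ ‖u.2‖ with h | h <;> rw [h] <;> nlinarith [sq_nonneg ‖u.1‖, sq_nonneg ‖u.2‖]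

lemma abs_phaseInner_le {n : ℕ} (u v : PhaseSpace n) : |phaseInner u v| ≤ 2 * ‖v‖ * ‖u‖ := by
  have h1 := abs_real_inner_le_norm u.1 v.1
  have h2 := abs_real_inner_le_norm u.2 v.2
  have h3 : ‖u.1‖ * ‖v.1‖ ≤ ‖u‖ * ‖v‖ := by
    gcongr
    exacts [norm_fst_le u, norm_fst_le v]
  have h4 : ‖u.2‖ * ‖v.2‖ ≤ ‖u‖ * ‖v‖ := by
    gcongr
    exacts [norm_snd_le u, norm_snd_le v]
  calc |phaseInner u v| ≤ |⟪u.1, v.1⟫| + |⟪u.2, v.2⟫| := abs_add_le _ _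
    _ ≤ _ := by linarith

lemma one_le_anharmonicWeight {n : ℕ} (k l : ℕ) (X : PhaseSpace n) :
    1 ≤ anharmonicWeight k l X := by
  unfold anharmonicWeight
  have : 0 ≤ ‖X.1‖ ^ k := by positivity
  have : 0 ≤ ‖X.2‖ ^ l := by positivity
  linarith

lemma anharmonicWeight_pos {n : ℕ} (k l : ℕ) (X : PhaseSpace n) : 0 < anharmonicWeight k l X :=
  zero_lt_one.trans_le (one_le_anharmonicWeight k l X)

lemma add_pow_le_two_pow_mul {s t : ℝ} (hs : 0 ≤ s) (ht : 0 ≤ t) (k : ℕ) :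
    (s + t) ^ k ≤ 2 ^ k * (s ^ k + t ^ k) := by
  rcases le_total s t with h | h
  · calc (s + t) ^ k ≤ (2 * t) ^ k := by gcongr; linarith
      _ = 2 ^ k * t ^ k := mul_pow _ _ _
      _ ≤ _ := by gcongr; linarith [pow_nonneg hs k]
  · calc (s + t) ^ k ≤ (2 * s) ^ k := by gcongr; linarith
      _ = 2 ^ k * s ^ k := mul_pow _ _ _
      _ ≤ _ := by gcongr; linarith [pow_nonneg ht k]

lemma pow_le_of_le_mul_one_add {s t A : ℝ} (hs : 0 ≤ s) (ht : 0 ≤ t) (hA : 1 ≤ A)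
    (h : s ≤ A * (1 + t)) {j K : ℕ} (hj : j ≤ K) : s ^ j ≤ 2 ^ K * A ^ K * (1 + t ^ j) := by
  have h2 : (1 + t) ^ j ≤ 2 ^ j * (1 + t ^ j) := by
    simpa using add_pow_le_two_pow_mul zero_le_one ht j
  calc s ^ j ≤ (A * (1 + t)) ^ j := by gcongr
    _ = A ^ j * (1 + t) ^ j := mul_pow _ _ _
    _ ≤ A ^ K * (2 ^ K * (1 + t ^ j)) := by
        gcongr
        refine h2.trans ?_
        gcongr
        norm_num
    _ = _ := by ring

/-- A Peetre-type inequality for the anharmonic weight. -/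
lemma anharmonicWeight_le {n : ℕ} (k l : ℕ) (X Y : PhaseSpace n) :
    anharmonicWeight k l X ≤
      (3 * 2 ^ (k + l)) * (1 + ‖X - Y‖) ^ (k + l) * anharmonicWeight k l Y := by
  have hu := norm_nonneg (X - Y)
  have key : ∀ {s t : ℝ}, 0 ≤ s → 0 ≤ t → s ≤ t + ‖X - Y‖ → s ≤ (1 + ‖X - Y‖) * (1 + t) := by
    intro s t hs ht h
    nlinarith [mul_nonneg hu ht]
  have h1 : ‖X.1‖ ≤ ‖Y.1‖ + ‖X - Y‖ := by
    have := norm_fst_le (X - Y)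
    have h := norm_add_le Y.1 (X.1 - Y.1)
    rw [add_sub_cancel] at h
    rw [Prod.fst_sub] at this
    linarith
  have h2 : ‖X.2‖ ≤ ‖Y.2‖ + ‖X - Y‖ := by
    have := norm_snd_le (X - Y)
    have h := norm_add_le Y.2 (X.2 - Y.2)
    rw [add_sub_cancel] at h
    rw [Prod.snd_sub] at this
    linarith
  have e1 := pow_le_of_le_mul_one_add (norm_nonneg _) (norm_nonneg _) (by linarith)
    (key (norm_nonneg _) (norm_nonneg _) h1) (Nat.le_add_right k l)
  have e2 := pow_le_of_le_mul_one_add (norm_nonneg _) (norm_nonneg _) (by linarith)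
    (key (norm_nonneg _) (norm_nonneg _) h2) (Nat.le_add_left l k)
  set B : ℝ := 2 ^ (k + l) * (1 + ‖X - Y‖) ^ (k + l) with hB
  have hB1 : 1 ≤ B := one_le_mul_of_one_le_of_one_le (one_le_pow₀ (by norm_num))
    (one_le_pow₀ (by linarith))
  have p1 : 0 ≤ ‖Y.1‖ ^ k := by positivity
  have p2 : 0 ≤ ‖Y.2‖ ^ l := by positivity
  calc anharmonicWeight k l X ≤ 1 + B * (1 + ‖Y.1‖ ^ k) + B * (1 + ‖Y.2‖ ^ l) := by
        unfold anharmonicWeight; linarith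
    _ ≤ 3 * B * anharmonicWeight k l Y := by
        unfold anharmonicWeight
        nlinarith [mul_nonneg (zero_le_one.trans hB1) p1, mul_nonneg (zero_le_one.trans hB1) p2]
    _ = _ := by rw [hB]; ring

lemma anharmonicWeight_rpow_le (n k l : ℕ) (s : ℝ) : ∃ C : ℝ, 0 < C ∧ ∃ K : ℕ,
    ∀ X Y : PhaseSpace n, anharmonicWeight k l X ^ s ≤
      C * (1 + ‖X - Y‖) ^ K * anharmonicWeight k l Y ^ s := by
  obtain ⟨j, hj⟩ := exists_nat_ge |s|
  refine ⟨(3 * 2 ^ (k + l)) ^ j, by positivity, (k + l) * j, fun X Y => ?_⟩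
  set A : ℝ := (3 * 2 ^ (k + l)) * (1 + ‖X - Y‖) ^ (k + l) with hA
  have hA1 : 1 ≤ A := by
    have h2 : (1 : ℝ) ≤ 2 ^ (k + l) := one_le_pow₀ (by norm_num)
    exact one_le_mul_of_one_le_of_one_le (by linarith)
      (one_le_pow₀ (by linarith [norm_nonneg (X - Y)]))
  have hA0 : 0 < A := zero_lt_one.trans_le hA1
  have hX := anharmonicWeight_pos k l X
  have hY := anharmonicWeight_pos k l Y
  have hAs : A ^ |s| ≤ (3 * 2 ^ (k + l)) ^ j * (1 + ‖X - Y‖) ^ ((k + l) * j) := by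
    calc A ^ |s| ≤ A ^ (j : ℝ) := Real.rpow_le_rpow_of_exponent_le hA1 hj
      _ = A ^ j := Real.rpow_natCast _ _
      _ = _ := by rw [hA, mul_pow, pow_mul]
  refine le_trans ?_ (mul_le_mul_of_nonneg_right hAs (Real.rpow_nonneg hY.le s))
  rcases le_total 0 s with hs | hs
  · rw [abs_of_nonneg hs, ← Real.mul_rpow hA0.le hY.le]
    exact Real.rpow_le_rpow hX.le (anharmonicWeight_le k l X Y) hs
  · have h := anharmonicWeight_le k l Y X
    rw [norm_sub_rev] at h
    have h' := Real.rpow_le_rpow hY.le h (neg_nonneg.2 hs)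
    rw [← hA, Real.mul_rpow hA0.le hX.le, Real.rpow_neg hY.le, Real.rpow_neg hX.le] at h'
    rw [abs_of_nonpos hs]
    have a1 := Real.rpow_pos_of_pos hX s
    have a2 := Real.rpow_pos_of_pos hY s
    rw [← div_eq_mul_inv, inv_le_comm₀ a2 (by positivity), inv_div, div_le_iff₀ (by positivity)] at h'
    linarith

lemma Polynomial.exists_abs_eval_le (q : Polynomial ℝ) : ∃ C : ℝ, 0 ≤ C ∧ ∃ d : ℕ,
    ∀ t : ℝ, |q.eval t| ≤ C * (1 + |t|) ^ d := by
  refine ⟨∑ i ∈ Finset.range (q.natDegree + 1), |q.coeff i|, by positivity, q.natDegree,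
    fun t => ?_⟩
  rw [Polynomial.eval_eq_sum_range, Finset.sum_mul]
  refine (Finset.abs_sum_le_sum_abs _ _).trans (Finset.sum_le_sum fun i hi => ?_)
  rw [abs_mul, abs_pow]
  have : i ≤ q.natDegree := Nat.lt_succ_iff.1 (Finset.mem_range.1 hi)
  gcongr
  calc |t| ^ i ≤ (1 + |t|) ^ i := by gcongr; linarith
    _ ≤ _ := pow_le_pow_right₀ (by linarith [abs_nonneg t]) this

lemma exists_one_add_pow_mul_exp_neg_sq_le (K : ℕ) : ∃ C : ℝ, 0 ≤ C ∧
    ∀ t : ℝ, 0 ≤ t → (1 + t) ^ K * Real.exp (-t ^ 2) ≤ C := by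
  refine ⟨(K.factorial : ℝ) * Real.exp 2, by positivity, fun t ht => ?_⟩
  have h := Real.pow_div_factorial_le_exp (1 + t) (by linarith) K
  rw [div_le_iff₀ (by positivity)] at h
  calc (1 + t) ^ K * Real.exp (-t ^ 2)
      ≤ Real.exp (1 + t) * (K.factorial : ℝ) * Real.exp (-t ^ 2) := by gcongr
    _ = (K.factorial : ℝ) * Real.exp (1 + t + -t ^ 2) := by rw [Real.exp_add (1 + t)]; ring
    _ ≤ _ := by
        gcongr
        nlinarith [sq_nonneg (t - 1 / 2)]

/-- The weighted atoms are dominated by translates of one integrable function. -/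
lemma exists_integrable_bound (n k l : ℕ) (s : ℝ) (q : Polynomial ℝ) (v : PhaseSpace n) :
    ∃ G : PhaseSpace n → ℝ, MeasureTheory.Integrable G ∧ (∀ u, 0 ≤ G u) ∧
      ∀ Z Y : PhaseSpace n, anharmonicWeight k l Y ^ s * |hermiteAtom q v Z Y| ≤
        anharmonicWeight k l Z ^ s * G (Y - Z) := by
  obtain ⟨C₁, hC₁, K, hK⟩ := anharmonicWeight_rpow_le n k l s
  obtain ⟨C₂, hC₂, d, hd⟩ := q.exists_abs_eval_le
  set D := Module.finrank ℝ (PhaseSpace n) + 1 with hD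
  obtain ⟨C₃, hC₃, h₃⟩ := exists_one_add_pow_mul_exp_neg_sq_le (K + d + D)
  refine ⟨fun u => C₁ * (C₂ * (1 + 2 * ‖v‖) ^ d) * C₃ * (1 + ‖u‖) ^ (-(D : ℝ)),
    (integrable_one_add_norm (by rw [hD]; push_cast; linarith)).const_mul _,
    fun u => by positivity, fun Z Y => ?_⟩
  set u := Y - Z with hu
  have hu0 := norm_nonneg u
  have hv0 := norm_nonneg v
  have hq : |q.eval (phaseInner u v)| ≤ C₂ * (1 + 2 * ‖v‖) ^ d * (1 + ‖u‖) ^ d := by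
    refine (hd _).trans ?_
    rw [mul_assoc, ← mul_pow]
    gcongr
    nlinarith [abs_phaseInner_le u v]
  have he : Real.exp (-phaseInner u u) ≤ Real.exp (-‖u‖ ^ 2) := by
    gcongr
    exact sq_norm_le_phaseInner_self u
  have hZ := Real.rpow_pos_of_pos (anharmonicWeight_pos k l Z) s
  have h₃' : (1 + ‖u‖) ^ K * (1 + ‖u‖) ^ d * Real.exp (-‖u‖ ^ 2) ≤
      C₃ * (1 + ‖u‖) ^ (-(D : ℝ)) := by
    rw [Real.rpow_neg (by positivity), Real.rpow_natCast, ← div_eq_mul_inv,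
      le_div_iff₀ (by positivity)]
    calc _ = (1 + ‖u‖) ^ (K + d + D) * Real.exp (-‖u‖ ^ 2) := by ring
      _ ≤ C₃ := h₃ _ hu0
  calc anharmonicWeight k l Y ^ s * |hermiteAtom q v Z Y|
      = anharmonicWeight k l Y ^ s * (|q.eval (phaseInner u v)| * Real.exp (-phaseInner u u)) := by
        rw [hermiteAtom, abs_mul, Real.abs_exp]
    _ ≤ (C₁ * (1 + ‖u‖) ^ K * anharmonicWeight k l Z ^ s) *
          ((C₂ * (1 + 2 * ‖v‖) ^ d * (1 + ‖u‖) ^ d) * Real.exp (-‖u‖ ^ 2)) := by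
        gcongr
        exact hK Y Z
    _ = C₁ * (C₂ * (1 + 2 * ‖v‖) ^ d) * anharmonicWeight k l Z ^ s *
          ((1 + ‖u‖) ^ K * (1 + ‖u‖) ^ d * Real.exp (-‖u‖ ^ 2)) := by ring
    _ ≤ C₁ * (C₂ * (1 + 2 * ‖v‖) ^ d) * anharmonicWeight k l Z ^ s *
          (C₃ * (1 + ‖u‖) ^ (-(D : ℝ))) := by gcongr
    _ = _ := by ring

lemma continuous_phaseInner_left {n : ℕ} (v : PhaseSpace n) :
    Continuous fun Y => phaseInner Y v := by
  unfold phaseInner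
  fun_prop

lemma continuous_hermiteAtom {n : ℕ} (q : Polynomial ℝ) (v Z : PhaseSpace n) :
    Continuous (hermiteAtom q v Z) := by
  unfold hermiteAtom
  refine (q.continuous.comp ((continuous_phaseInner_left v).comp
    (continuous_id.sub continuous_const))).mul (Real.continuous_exp.comp ?_)
  unfold phaseInner
  fun_prop

lemma continuous_planeWave {n : ℕ} (W : PhaseSpace n) : Continuous (planeWave W) := by
  unfold planeWave
  exact Complex.continuous_exp.comp (continuous_const.mul
    (Complex.continuous_ofReal.comp (continuous_phaseInner_left W)))

/-- The integrand of the short-time Fourier transform with window `hermiteAtom q v`. -/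
def stftIntegrand {n : ℕ} (b : PhaseSpace n → ℂ) (q : Polynomial ℝ) (v Z W Y : PhaseSpace n) : ℂ :=
  b Y * (hermiteAtom q v Z Y : ℂ) * planeWave W Y

lemma exists_norm_integral_stftIntegrand_le {n : ℕ} (k l : ℕ) (s : ℝ) (q : Polynomial ℝ)
    (v : PhaseSpace n) {b : PhaseSpace n → ℂ} (hb : Continuous b) {B : ℝ} (hB : 0 < B)
    (hbB : ∀ Y, ‖b Y‖ ≤ B * anharmonicWeight k l Y ^ s) :
    ∃ C : ℝ, 0 < C ∧ ∀ Z W : PhaseSpace n,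
      MeasureTheory.Integrable (stftIntegrand b q v Z W) ∧
      ‖∫ Y, stftIntegrand b q v Z W Y‖ ≤ C * anharmonicWeight k l Z ^ s := by
  obtain ⟨G, hG, hG0, hGb⟩ := exists_integrable_bound n k l s q v
  have hbound : ∀ Z W Y : PhaseSpace n, ‖stftIntegrand b q v Z W Y‖ ≤
      B * anharmonicWeight k l Z ^ s * G (Y - Z) := by
    intro Z W Y
    rw [stftIntegrand, norm_mul, norm_mul, norm_planeWave, mul_one, Complex.norm_real,
      Real.norm_eq_abs]
    calc ‖b Y‖ * |hermiteAtom q v Z Y|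
        ≤ B * anharmonicWeight k l Y ^ s * |hermiteAtom q v Z Y| := by
          gcongr
          exact hbB Y
      _ = B * (anharmonicWeight k l Y ^ s * |hermiteAtom q v Z Y|) := by ring
      _ ≤ B * (anharmonicWeight k l Z ^ s * G (Y - Z)) := by
          exact mul_le_mul_of_nonneg_left (hGb Z Y) hB.le
      _ = _ := by ring
  have hI : 0 ≤ ∫ u, G u := MeasureTheory.integral_nonneg hG0
  refine ⟨B * ((∫ u, G u) + 1), by positivity, fun Z W => ?_⟩
  have hint : MeasureTheory.Integrable fun Y => B * anharmonicWeight k l Z ^ s * G (Y - Z) :=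
    (hG.comp_sub_right Z).const_mul _
  have hZ := Real.rpow_pos_of_pos (anharmonicWeight_pos k l Z) s
  refine ⟨hint.mono' ?_ (Filter.Eventually.of_forall (hbound Z W)), ?_⟩
  · exact ((hb.mul (Complex.continuous_ofReal.comp (continuous_hermiteAtom q v Z))).mul
      (continuous_planeWave W)).aestronglyMeasurable
  · refine (MeasureTheory.norm_integral_le_of_norm_le hint
      (Filter.Eventually.of_forall (hbound Z W))).trans ?_
    rw [MeasureTheory.integral_const_mul, MeasureTheory.integral_sub_right_eq_self G Z]
    nlinarith [mul_pos hB hZ]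

lemma phaseInner_comm {n : ℕ} (u v : PhaseSpace n) : phaseInner u v = phaseInner v u := by
  simp [phaseInner, real_inner_comm]

lemma phaseInner_add_left {n : ℕ} (u v w : PhaseSpace n) :
    phaseInner (u + v) w = phaseInner u w + phaseInner v w := by
  simp only [phaseInner, Prod.fst_add, Prod.snd_add, inner_add_left]
  ring

lemma phaseInner_smul_left {n : ℕ} (t : ℝ) (u w : PhaseSpace n) :
    phaseInner (t • u) w = t * phaseInner u w := by
  simp only [phaseInner, Prod.smul_fst, Prod.smul_snd, real_inner_smul_left]
  ring

lemma hasLineDerivAt_hermiteAtom {n : ℕ} (q : Polynomial ℝ) {v : PhaseSpace n}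
    (hv : phaseInner v v = 1) (Z Y : PhaseSpace n) :
    HasLineDerivAt ℝ (hermiteAtom q v Z)
      (hermiteAtom (q.derivative - Polynomial.C 2 * Polynomial.X * q) v Z Y) Y v := by
  have hfun : (fun t : ℝ => hermiteAtom q v Z (Y + t • v)) = fun t : ℝ =>
      q.eval (phaseInner (Y - Z) v + t) *
        Real.exp (-(phaseInner (Y - Z) (Y - Z) + 2 * phaseInner (Y - Z) v * t + t ^ 2)) := by
    funext t
    have h : Y + t • v - Z = (Y - Z) + t • v := by abel
    have h1 : phaseInner (Y - Z + t • v) v = phaseInner (Y - Z) v + t := by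
      rw [phaseInner_add_left, phaseInner_smul_left, hv, mul_one]
    rw [hermiteAtom, h, h1]
    congr 3
    rw [phaseInner_add_left, phaseInner_smul_left, phaseInner_comm v, h1,
      phaseInner_comm _ (Y - Z + _), phaseInner_add_left, phaseInner_smul_left,
      phaseInner_comm v]
    ring
  unfold HasLineDerivAt
  rw [hfun]
  have h1 : HasDerivAt (fun t : ℝ => q.eval (phaseInner (Y - Z) v + t))
      (q.derivative.eval (phaseInner (Y - Z) v)) 0 := by
    have := (q.hasDerivAt (phaseInner (Y - Z) v + 0)).comp_const_add (phaseInner (Y - Z) v) 0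
    simpa using this
  have h2 : HasDerivAt (fun t : ℝ =>
      -(phaseInner (Y - Z) (Y - Z) + 2 * phaseInner (Y - Z) v * t + t ^ 2))
      (-(2 * phaseInner (Y - Z) v)) 0 := by
    have := ((((hasDerivAt_id (0 : ℝ)).const_mul (2 * phaseInner (Y - Z) v)).const_add
      (phaseInner (Y - Z) (Y - Z))).add ((hasDerivAt_id (0 : ℝ)).pow 2)).neg
    convert! this using 1
    simp
  convert! h1.mul h2.exp using 1
  simp [hermiteAtom]
  ring

lemma hasLineDerivAt_planeWave {n : ℕ} (v W Y : PhaseSpace n) :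
    HasLineDerivAt ℝ (planeWave W)
      (-Complex.I * (phaseInner v W : ℂ) * planeWave W Y) Y v := by
  have h1 : HasDerivAt (fun t : ℝ => -Complex.I * ((phaseInner (Y + t • v) W : ℝ) : ℂ))
      (-Complex.I * (phaseInner v W : ℂ)) 0 := by
    simp only [phaseInner_add_left, phaseInner_smul_left]
    have := (((hasDerivAt_id (0 : ℝ)).mul_const (phaseInner v W)).const_add
      (phaseInner Y W)).ofReal_comp.const_mul (-Complex.I)
    simpa using this
  have := h1.cexp
  simp only [zero_smul, add_zero] at this
  rw [mul_comm]
  exact this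

lemma integral_eq_zero_of_hasLineDerivAt {n : ℕ} {g g' : PhaseSpace n → ℂ} {v : PhaseSpace n}
    (hg : MeasureTheory.Integrable g) (hg' : MeasureTheory.Integrable g')
    (h : ∀ Y, HasLineDerivAt ℝ g (g' Y) Y v) : ∫ Y, g' Y = 0 := by
  have := integral_bilinear_hasLineDerivAt_right_eq_neg_left_of_integrable
    (μ := MeasureTheory.volume) (f := fun _ : PhaseSpace n => (1 : ℂ)) (f' := fun _ => 0)
    (g := g) (g' := g') (v := v) (B := ContinuousLinearMap.mul ℝ ℂ)
    (by simp) (by simpa using hg') (by simpa using hg)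
    (fun Y _ => by simpa [HasLineDerivAt] using hasDerivAt_const (0 : ℝ) (1 : ℂ))
    (fun Y _ => h Y)
  simpa using this

/-- Integration by parts in the direction `v`. -/
lemma integral_stftIntegrand_by_parts {n : ℕ} (q : Polynomial ℝ) {v : PhaseSpace n}
    (hv : phaseInner v v = 1) {b : PhaseSpace n → ℂ} (hb : Differentiable ℝ b)
    (Z W : PhaseSpace n) (h₀ : MeasureTheory.Integrable (stftIntegrand b q v Z W))
    (h₁ : MeasureTheory.Integrable (stftIntegrand (fun Y => fderiv ℝ b Y v) q v Z W))
    (h₂ : MeasureTheory.Integrable (stftIntegrand b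
      (q.derivative - Polynomial.C 2 * Polynomial.X * q) v Z W)) :
    Complex.I * (phaseInner v W : ℂ) * ∫ Y, stftIntegrand b q v Z W Y =
      (∫ Y, stftIntegrand (fun Y => fderiv ℝ b Y v) q v Z W Y) +
      ∫ Y, stftIntegrand b (q.derivative - Polynomial.C 2 * Polynomial.X * q) v Z W Y := by
  have h := integral_eq_zero_of_hasLineDerivAt (v := v) h₀
    ((h₁.add h₂).sub (h₀.const_mul (Complex.I * (phaseInner v W : ℂ)))) fun Y => by
      have d1 : HasDerivAt (fun t : ℝ => b (Y + t • v)) (fderiv ℝ b Y v) 0 :=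
        (hb Y).hasFDerivAt.hasLineDerivAt v
      have d2 : HasDerivAt (fun t : ℝ => ((hermiteAtom q v Z (Y + t • v) : ℝ) : ℂ)) _ 0 :=
        HasDerivAt.ofReal_comp (hasLineDerivAt_hermiteAtom q hv Z Y)
      have d3 : HasDerivAt (fun t : ℝ => planeWave W (Y + t • v)) _ 0 :=
        hasLineDerivAt_planeWave v W Y
      have d := (d1.mul d2).mul d3
      unfold HasLineDerivAt
      convert! d using 1
      simp only [Pi.add_apply, Pi.sub_apply, stftIntegrand, Pi.mul_apply, zero_smul, add_zero]
      ring
  rw [MeasureTheory.integral_sub' (h₁.add h₂) (h₀.const_mul _),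
    MeasureTheory.integral_const_mul, MeasureTheory.integral_add' h₁ h₂] at h
  exact (sub_eq_zero.1 h).symm

lemma exists_pow_mul_norm_integral_stftIntegrand_le {n : ℕ} (k l : ℕ) (s : ℝ) {v : PhaseSpace n}
    (hv : phaseInner v v = 1) (b : ℕ → PhaseSpace n → ℂ) (hb : ∀ r, Differentiable ℝ (b r))
    (hb' : ∀ r, b (r + 1) = fun Y => fderiv ℝ (b r) Y v)
    (hbB : ∀ r, ∃ B : ℝ, 0 < B ∧ ∀ Y, ‖b r Y‖ ≤ B * anharmonicWeight k l Y ^ s) (M : ℕ) :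
    ∀ (r : ℕ) (q : Polynomial ℝ), ∃ C : ℝ, 0 < C ∧ ∀ Z W : PhaseSpace n,
      |phaseInner v W| ^ M * ‖∫ Y, stftIntegrand (b r) q v Z W Y‖ ≤
        C * anharmonicWeight k l Z ^ s := by
  have base : ∀ (r : ℕ) (q : Polynomial ℝ), ∃ C : ℝ, 0 < C ∧ ∀ Z W : PhaseSpace n,
      MeasureTheory.Integrable (stftIntegrand (b r) q v Z W) ∧
      ‖∫ Y, stftIntegrand (b r) q v Z W Y‖ ≤ C * anharmonicWeight k l Z ^ s := by
    intro r q
    obtain ⟨B, hB, h⟩ := hbB r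
    exact exists_norm_integral_stftIntegrand_le k l s q v (hb r).continuous hB h
  induction M with
  | zero =>
    intro r q
    obtain ⟨C, hC, h⟩ := base r q
    exact ⟨C, hC, fun Z W => by simpa using (h Z W).2⟩
  | succ M ih =>
    intro r q
    obtain ⟨C₁, hC₁, h₁⟩ := ih (r + 1) q
    obtain ⟨C₂, hC₂, h₂⟩ := ih r (q.derivative - Polynomial.C 2 * Polynomial.X * q)
    obtain ⟨_, _, i₀⟩ := base r q
    obtain ⟨_, _, i₁⟩ := base (r + 1) q
    obtain ⟨_, _, i₂⟩ := base r (q.derivative - Polynomial.C 2 * Polynomial.X * q)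
    refine ⟨C₁ + C₂, by positivity, fun Z W => ?_⟩
    have h := integral_stftIntegrand_by_parts q hv (hb r) Z W (i₀ Z W).1
      (hb' r ▸ (i₁ Z W).1) (i₂ Z W).1
    rw [← hb' r] at h
    have hn := congrArg norm h
    rw [norm_mul, norm_mul, Complex.norm_I, one_mul, Complex.norm_real, Real.norm_eq_abs] at hn
    rw [pow_succ, mul_assoc, hn]
    have := mul_le_mul_of_nonneg_left (norm_add_le (∫ Y, stftIntegrand (b (r + 1)) q v Z W Y)
      (∫ Y, stftIntegrand (b r) (q.derivative - Polynomial.C 2 * Polynomial.X * q) v Z W Y))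
      (pow_nonneg (abs_nonneg (phaseInner v W)) M)
    linarith [h₁ Z W, h₂ Z W]

lemma contDiff_pderivSeq {n : ℕ} {a : PhaseSpace n → ℂ} (ha : ContDiff ℝ (⊤ : ℕ∞) a)
    (L : List (Fin n ⊕ Fin n)) : ContDiff ℝ (⊤ : ℕ∞) (pderivSeq n L a) := by
  induction L with
  | nil => exact ha
  | cons i L ih =>
    simp only [pderivSeq]
    exact (ih.fderiv_right (m := (⊤ : ℕ∞)) (by simp)).clm_apply contDiff_const

lemma phaseInner_phaseDir_inl {n : ℕ} (j : Fin n) (W : PhaseSpace n) :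
    phaseInner (phaseDir n (Sum.inl j)) W = W.1 j := by
  simp [phaseInner, phaseDir, EuclideanSpace.inner_single_left]

lemma phaseInner_phaseDir_inr {n : ℕ} (j : Fin n) (W : PhaseSpace n) :
    phaseInner (phaseDir n (Sum.inr j)) W = W.2 j := by
  simp [phaseInner, phaseDir, EuclideanSpace.inner_single_left]

lemma phaseInner_phaseDir_self {n : ℕ} (i : Fin n ⊕ Fin n) :
    phaseInner (phaseDir n i) (phaseDir n i) = 1 := by
  rcases i with j | j
  · rw [phaseInner_phaseDir_inl]; simp [phaseDir]
  · rw [phaseInner_phaseDir_inr]; simp [phaseDir]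

lemma SigmaClass.exists_norm_pderivSeq_replicate_le {n k l : ℕ} {s : ℝ} {a : PhaseSpace n → ℂ}
    (ha : SigmaClass n k l s a) (i : Fin n ⊕ Fin n) (r : ℕ) :
    ∃ B : ℝ, 0 < B ∧ ∀ Y, ‖pderivSeq n (List.replicate r i) a Y‖ ≤
      B * anharmonicWeight k l Y ^ s := by
  rcases i with j | j
  · obtain ⟨B, hB, h⟩ := ha.2 (List.replicate r j) []
    refine ⟨B, hB, fun Y => ?_⟩
    have h' := h Y.1 Y.2
    simp only [List.map_replicate, List.map_nil, List.append_nil, List.length_replicate] at h'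
    refine h'.trans ?_
    unfold anharmonicWeight
    gcongr
    · exact one_le_anharmonicWeight k l Y
    · have : 0 ≤ (r : ℝ) / k := by positivity
      simpa using this
  · obtain ⟨B, hB, h⟩ := ha.2 [] (List.replicate r j)
    refine ⟨B, hB, fun Y => ?_⟩
    have h' := h Y.1 Y.2
    simp only [List.map_replicate, List.map_nil, List.nil_append, List.length_replicate] at h'
    refine h'.trans ?_
    unfold anharmonicWeight
    gcongr
    · exact one_le_anharmonicWeight k l Y
    · have : 0 ≤ (r : ℝ) / l := by positivity
      simpa using this

lemma STFT2n_eq_integral_stftIntegrand {n : ℕ} (a : PhaseSpace n → ℂ) (v Z W : PhaseSpace n) :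
    STFT2n n a Z W = ∫ Y, stftIntegrand a 1 v Z W Y := by
  unfold STFT2n stftIntegrand hermiteAtom planeWave
  congr 1
  funext Y
  rw [phaseInner_self]
  simp [phaseInner]

lemma SigmaClass.exists_pow_mul_norm_STFT2n_le {n k l : ℕ} {s : ℝ} {a : PhaseSpace n → ℂ}
    (ha : SigmaClass n k l s a) (i : Fin n ⊕ Fin n) (M : ℕ) :
    ∃ C : ℝ, 0 < C ∧ ∀ Z W : PhaseSpace n,
      |phaseInner (phaseDir n i) W| ^ M * ‖STFT2n n a Z W‖ ≤ C * anharmonicWeight k l Z ^ s := by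
  obtain ⟨C, hC, h⟩ := exists_pow_mul_norm_integral_stftIntegrand_le k l s
    (phaseInner_phaseDir_self i) (fun r => pderivSeq n (List.replicate r i) a)
    (fun r => (contDiff_pderivSeq ha.1 _).differentiable (by simp))
    (fun r => rfl) (ha.exists_norm_pderivSeq_replicate_le i) M 0 1
  refine ⟨C, hC, fun Z W => ?_⟩
  rw [STFT2n_eq_integral_stftIntegrand a (phaseDir n i)]
  exact h Z W

lemma EuclideanSpace.norm_le_of_forall_abs_le {n : ℕ} (x : EuclideanSpace ℝ (Fin n)) {t : ℝ}
    (h : ∀ j, |x j| ≤ t) : ‖x‖ ≤ n * t := by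
  have h1 : ‖x‖ ≤ ∑ j, ‖x j‖ := by
    conv_lhs => rw [← (EuclideanSpace.basisFun (Fin n) ℝ).sum_repr x]
    refine (norm_sum_le _ _).trans (Finset.sum_le_sum fun j _ => ?_)
    simp [norm_smul]
  refine h1.trans ((Finset.sum_le_sum fun j _ => h j).trans ?_)
  simp

/-- The weight is controlled by the largest coordinate. -/
lemma exists_anharmonicWeight_pow_le {n : ℕ} (hn : 1 ≤ n) (k l N : ℕ) :
    ∃ C : ℝ, 0 < C ∧ ∀ W : PhaseSpace n, ∃ i : Fin n ⊕ Fin n,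
      anharmonicWeight k l W ^ N ≤
        C * (1 + |phaseInner (phaseDir n i) W| ^ ((k + l) * N)) := by
  refine ⟨(3 * n ^ (k + l)) ^ N * 2 ^ ((k + l) * N), by positivity, fun W => ?_⟩
  have : Nonempty (Fin n ⊕ Fin n) := ⟨Sum.inl ⟨0, hn⟩⟩
  obtain ⟨i, hi⟩ := Finite.exists_max fun i => |phaseInner (phaseDir n i) W|
  refine ⟨i, ?_⟩
  set t := |phaseInner (phaseDir n i) W| with ht
  have ht0 : 0 ≤ t := abs_nonneg _
  have hn' : (1 : ℝ) ≤ n := by exact_mod_cast hn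
  have h1 : ‖W.1‖ ≤ n * t := EuclideanSpace.norm_le_of_forall_abs_le _ fun j => by
    simpa [phaseInner_phaseDir_inl] using hi (Sum.inl j)
  have h2 : ‖W.2‖ ≤ n * t := EuclideanSpace.norm_le_of_forall_abs_le _ fun j => by
    simpa [phaseInner_phaseDir_inr] using hi (Sum.inr j)
  have key : ∀ {x : ℝ} {j : ℕ}, 0 ≤ x → x ≤ n * t → j ≤ k + l →
      x ^ j ≤ n ^ (k + l) * (1 + t) ^ (k + l) := by
    intro x j hx hxt hj
    rw [← mul_pow]
    have h1 : (1 : ℝ) ≤ n * (1 + t) := by nlinarith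
    calc x ^ j ≤ (n * (1 + t)) ^ j := by gcongr; nlinarith
      _ ≤ _ := pow_le_pow_right₀ h1 hj
  have e1 := key (norm_nonneg _) h1 (Nat.le_add_right k l)
  have e2 := key (norm_nonneg _) h2 (Nat.le_add_left l k)
  have e0 : (1 : ℝ) ≤ n ^ (k + l) * (1 + t) ^ (k + l) :=
    one_le_mul_of_one_le_of_one_le (one_le_pow₀ hn') (one_le_pow₀ (by linarith))
  have e3 : anharmonicWeight k l W ≤ 3 * n ^ (k + l) * (1 + t) ^ (k + l) := by
    unfold anharmonicWeight; linarith
  have e4 : (1 + t) ^ ((k + l) * N) ≤ 2 ^ ((k + l) * N) * (1 + t ^ ((k + l) * N)) := by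
    simpa using add_pow_le_two_pow_mul zero_le_one ht0 ((k + l) * N)
  calc anharmonicWeight k l W ^ N ≤ (3 * n ^ (k + l) * (1 + t) ^ (k + l)) ^ N := by
        gcongr
        exact (anharmonicWeight_pos k l W).le
    _ = (3 * n ^ (k + l)) ^ N * (1 + t) ^ ((k + l) * N) := by rw [mul_pow, pow_mul]
    _ ≤ (3 * n ^ (k + l)) ^ N * (2 ^ ((k + l) * N) * (1 + t ^ ((k + l) * N))) := by gcongr
    _ = (3 * n ^ (k + l)) ^ N * 2 ^ ((k + l) * N) * (1 + t ^ ((k + l) * N)) := by ring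

/-- If `a ∈ Σ^{-m}_{k,ℓ}` then its short-time Fourier transform with Gaussian window
satisfies `|V_φ a(Z,W)| ≤ C_N (1+|z|^k+|ζ|^ℓ)^{-m} (1+|w|^k+|τ|^ℓ)^{-2N}` for every `N`. -/
theorem stft_decay_of_symbol (k l n : ℕ) (m : ℝ) (hk : 1 ≤ k) (hl : 1 ≤ l) (hn : 1 ≤ n)
    (a : (EuclideanSpace ℝ (Fin n) × EuclideanSpace ℝ (Fin n)) → ℂ)
    (ha : SigmaClass n k l (-m) a) :
    ∀ N : ℕ, ∃ C : ℝ, 0 < C ∧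
      ∀ z ζ w τ : EuclideanSpace ℝ (Fin n),
        ‖STFT2n n a (z, ζ) (w, τ)‖ ≤
          C * (1 + ‖z‖ ^ k + ‖ζ‖ ^ l) ^ (-m) *
            (1 + ‖w‖ ^ k + ‖τ‖ ^ l) ^ (-(2 * N : ℝ)) := by
  intro N
  obtain ⟨C₀, hC₀, h₀⟩ := exists_anharmonicWeight_pow_le hn k l (2 * N)
  choose A hA hA' using fun i => ha.exists_pow_mul_norm_STFT2n_le i 0
  choose B hB hB' using fun i => ha.exists_pow_mul_norm_STFT2n_le i ((k + l) * (2 * N))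
  have : Nonempty (Fin n ⊕ Fin n) := ⟨Sum.inl ⟨0, hn⟩⟩
  refine ⟨C₀ * ∑ i, (A i + B i), mul_pos hC₀ (Finset.sum_pos (fun i _ => add_pos (hA i) (hB i))
    Finset.univ_nonempty), fun z ζ w τ => ?_⟩
  obtain ⟨i, hi⟩ := h₀ (w, τ)
  have hW := anharmonicWeight_pos k l (w, τ)
  have hZ := Real.rpow_pos_of_pos (anharmonicWeight_pos k l (z, ζ)) (-m)
  have hAi := hA' i (z, ζ) (w, τ)
  have hBi := hB' i (z, ζ) (w, τ)
  rw [pow_zero, one_mul] at hAi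
  have hsum : A i + B i ≤ ∑ i, (A i + B i) :=
    Finset.single_le_sum (f := fun i => A i + B i) (fun i _ => (add_pos (hA i) (hB i)).le)
      (Finset.mem_univ i)
  change _ ≤ _ * anharmonicWeight k l (z, ζ) ^ (-m) * anharmonicWeight k l (w, τ) ^ (-(2 * N : ℝ))
  rw [Real.rpow_neg hW.le, show (2 * N : ℝ) = ((2 * N : ℕ) : ℝ) by push_cast; ring,
    Real.rpow_natCast, ← div_eq_mul_inv, le_div_iff₀ (by positivity)]
  calc _ ≤ ‖STFT2n n a (z, ζ) (w, τ)‖ *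
        (C₀ * (1 + |phaseInner (phaseDir n i) (w, τ)| ^ ((k + l) * (2 * N)))) := by gcongr
    _ ≤ C₀ * (A i + B i) * anharmonicWeight k l (z, ζ) ^ (-m) := by
        nlinarith [mul_le_mul_of_nonneg_left (add_le_add hAi hBi) hC₀.le]
    _ ≤ _ := by gcongr
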